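/- arXiv:1709.08305 — 2 statements merged into one kernel-verified Lean document; each statement's English description precedes it below -/
import Mathlib

section
/- Let f : ℂ → ℂ be holomorphic in a neighborhood of the closed upper half-plane, integrable on ℝ, and such that F(z) = ∫_ℝ f(ω)/(z - iω) dω is defined for Re(z) ≠ 0. Then the function F̃ defined by F̃(z) = F(z) for Re(z) > 0, F̃(z) = lim_{x→0+} F(x + iy) for Re(z) = 0 (z = iy), and F̃(z) = F(z) + 2π f(-iz) for Re(z) < 0, is an entire function (i.e., the analytic continuation of F from the right half-plane across the imaginary axis is F(z) + 2π f(-iz)). -/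
open MeasureTheory Filter Topology Set

/-- Holomorphic dependence on a parameter of an integral whose integrand is dominated. -/
theorem differentiableOn_integral_of_dominated {α : Type*} [MeasurableSpace α] {μ : Measure α}
    {k : ℂ → α → ℂ} {U : Set ℂ} {bound : α → ℝ} (hU : IsOpen U)
    (hmeas : ∀ w ∈ U, AEStronglyMeasurable (k w) μ)
    (hdiff : ∀ᵐ t ∂μ, DifferentiableOn ℂ (fun w => k w t) U)
    (hbound : ∀ᵐ t ∂μ, ∀ w ∈ U, ‖k w t‖ ≤ bound t) (hint : Integrable bound μ) :
    DifferentiableOn ℂ (fun w => ∫ t, k w t ∂μ) U := by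
  intro w₀ hw₀
  obtain ⟨r, hr, hrU⟩ := Metric.isOpen_iff.1 hU w₀ hw₀
  have hr2 : 0 < r / 2 := by positivity
  have hsub : ∀ w ∈ Metric.ball w₀ (r / 2), ∀ z ∈ Metric.closedBall w (r / 3), z ∈ U := by
    intro w hw z hz
    apply hrU
    rw [Metric.mem_ball] at hw ⊢
    rw [Metric.mem_closedBall] at hz
    linarith [dist_triangle z w w₀]
  have hdiffAt : ∀ᵐ t ∂μ, ∀ w ∈ U, DifferentiableAt ℂ (fun w => k w t) w := by
    filter_upwards [hdiff] with t ht w hw using ht.differentiableAt (hU.mem_nhds hw)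
  refine (hasDerivAt_integral_of_dominated_loc_of_deriv_le (Metric.ball_mem_nhds w₀ hr2)
    (F' := fun w t => deriv (fun w => k w t) w) (bound := fun t => bound t / (r / 3))
    ?_ ?_ ?_ ?_ ?_ ?_).2.differentiableAt.differentiableWithinAt
  · filter_upwards [hU.mem_nhds hw₀] with w hw using hmeas w hw
  · exact hint.mono' (hmeas w₀ hw₀) (hbound.mono fun t ht => ht w₀ hw₀)
  · have hu : Tendsto (fun n : ℕ => w₀ + (r / 2 : ℝ) * (1 / ((n : ℂ) + 1))) atTop (𝓝[≠] w₀) := by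
      refine tendsto_nhdsWithin_iff.2 ⟨?_, Eventually.of_forall fun n => ?_⟩
      · simpa using (tendsto_one_div_add_atTop_nhds_zero_nat (𝕜 := ℂ)).const_mul
          ((r / 2 : ℝ) : ℂ) |>.const_add w₀
      · have h1 : ((n : ℂ) + 1) ≠ 0 := by exact_mod_cast n.succ_ne_zero
        have h2 : ((r / 2 : ℝ) : ℂ) ≠ 0 := by exact_mod_cast hr2.ne'
        simpa [h1] using hr.ne'
    have hmem : ∀ᶠ w in 𝓝[≠] w₀, w ∈ U := mem_nhdsWithin_of_mem_nhds (hU.mem_nhds hw₀)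
    obtain ⟨N, hN⟩ := eventually_atTop.1 (hu.eventually hmem)
    refine aestronglyMeasurable_of_tendsto_ae atTop
      (f := fun n t => slope (fun w => k w t) w₀
        (w₀ + (r / 2 : ℝ) * (1 / (((n + N : ℕ) : ℂ) + 1)))) (fun n => ?_) ?_
    · simp only [slope_def_field]
      exact ((hmeas _ (hN _ (Nat.le_add_left N n))).sub (hmeas w₀ hw₀)).mul_const _ |>.congr
        (Eventually.of_forall fun t => (div_eq_mul_inv _ _).symm)
    · filter_upwards [hdiffAt] with t ht
      exact ((hasDerivAt_iff_tendsto_slope.1 (ht w₀ hw₀).hasDerivAt).comp hu).comp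
        (tendsto_add_atTop_nat N)
  · filter_upwards [hdiff, hbound] with t ht hb w hw
    refine Complex.norm_deriv_le_of_forall_mem_sphere_norm_le (by positivity) ?_ fun z hz =>
      hb z (hsub w hw z (Metric.sphere_subset_closedBall hz))
    refine (ht.mono fun z hz => hsub w hw z ?_).diffContOnCl
    exact Metric.closure_ball_subset_closedBall hz
  · exact hint.div_const _
  · filter_upwards [hdiffAt] with t ht w hw
    exact (ht w (hsub w hw w (Metric.mem_closedBall_self (by positivity)))).hasDerivAt

theorem ofReal_sub_ne_zero {w : ℂ} (hw : w.im ≠ 0) (t : ℝ) : (t : ℂ) - w ≠ 0 := fun h => hw <| by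
  simpa using congrArg Complex.im h

/-- The Cauchy kernel is integrable against an integrable density at positive distance. -/
theorem integrable_div_ofReal_sub {μ : Measure ℝ} {g : ℝ → ℂ} (hg : Integrable g μ) {w : ℂ} {c : ℝ}
    (hc : 0 < c) (hdist : ∀ᵐ t : ℝ ∂μ, c ≤ ‖(t : ℂ) - w‖) :
    Integrable (fun t : ℝ => g t / ((t : ℂ) - w)) μ := by
  refine (hg.norm.div_const c).mono' (hg.aestronglyMeasurable.div₀ ?_ ) ?_
  · exact (by fun_prop : Measurable fun t : ℝ => (t : ℂ) - w).aestronglyMeasurable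
  · filter_upwards [hdist] with t ht
    rw [norm_div]
    gcongr

theorem differentiableOn_cauchyIntegral {μ : Measure ℝ} {g : ℝ → ℂ} (hg : Integrable g μ)
    {W : Set ℂ} (hW : IsOpen W) {c : ℝ} (hc : 0 < c)
    (hdist : ∀ᵐ t : ℝ ∂μ, ∀ w ∈ W, c ≤ ‖(t : ℂ) - w‖) :
    DifferentiableOn ℂ (fun w => ∫ t : ℝ, g t / ((t : ℂ) - w) ∂μ) W := by
  refine differentiableOn_integral_of_dominated hW (bound := fun t => ‖g t‖ / c)
    (fun w hw => (integrable_div_ofReal_sub hg hc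
      (hdist.mono fun t ht => ht w hw)).aestronglyMeasurable) ?_ ?_ (hg.norm.div_const c)
  · filter_upwards [hdist] with t ht
    refine (differentiableOn_const _).div (by fun_prop) fun w hw h => ?_
    have := ht w hw
    rw [h, norm_zero] at this
    linarith
  · filter_upwards [hdist] with t ht w hw
    rw [norm_div]
    gcongr
    exact ht w hw

theorem abs_im_le_norm_ofReal_sub (t : ℝ) (w : ℂ) : |w.im| ≤ ‖(t : ℂ) - w‖ := by
  simpa using Complex.abs_im_le_norm ((t : ℂ) - w)

theorem differentiableAt_cauchyIntegral {g : ℝ → ℂ} (hg : Integrable g) {w : ℂ} (hw : w.im ≠ 0) :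
    DifferentiableAt ℂ (fun w => ∫ t : ℝ, g t / ((t : ℂ) - w)) w := by
  have hpos : 0 < |w.im| / 2 := by positivity
  refine (differentiableOn_cauchyIntegral hg (Metric.isOpen_ball (x := w) (ε := |w.im| / 2)) hpos
    (Eventually.of_forall fun t z hz => ?_)).differentiableAt (Metric.ball_mem_nhds w hpos)
  have h1 : |w.im - z.im| ≤ dist w z := by
    simpa [dist_eq_norm] using Complex.abs_im_le_norm (w - z)
  rw [Metric.mem_ball, dist_comm] at hz
  linarith [abs_im_le_norm_ofReal_sub t z, abs_sub_abs_le_abs_sub w.im z.im]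

theorem setIntegral_Ioo_inv_ofReal_sub {w : ℂ} (hw : w.im ≠ 0) {a b : ℝ} (hab : a ≤ b) :
    ∫ t in Ioo a b, 1 / ((t : ℂ) - w) = Complex.log (b - w) - Complex.log (a - w) := by
  rw [← integral_Ioc_eq_integral_Ioo, ← intervalIntegral.integral_of_le hab]
  refine intervalIntegral.integral_eq_sub_of_hasDerivAt (f := fun t : ℝ => Complex.log (t - w))
    (fun t _ => ?_) ?_
  · refine HasDerivAt.clog_real ((Complex.ofRealCLM.hasDerivAt (x := t)).sub_const w) ?_
    exact Or.inr (by simpa using hw)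
  · refine Continuous.intervalIntegrable ?_ _ _
    exact continuous_const.div (by fun_prop) (ofReal_sub_ne_zero hw)

theorem Complex.log_sub_of_im_neg {w z : ℂ} (h : (w - z).im < 0) :
    Complex.log (z - w) = Complex.log (w - z) + Real.pi * Complex.I := by
  rw [← neg_sub w z, Complex.log, Complex.log, norm_neg, Complex.arg_neg_eq_arg_add_pi_of_im_neg h]
  push_cast; ring

theorem Complex.log_sub_of_im_pos {w z : ℂ} (h : 0 < (w - z).im) :
    Complex.log (z - w) = Complex.log (w - z) - Real.pi * Complex.I := by
  rw [← neg_sub w z, Complex.log, Complex.log, norm_neg, Complex.arg_neg_eq_arg_sub_pi_of_im_pos h]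
  push_cast; ring

/-- Local analytic continuation of a Cauchy integral from below the real axis, with the
Sokhotski–Plemelj jump above it. -/
theorem exists_local_continuation {f : ℂ → ℂ} {U : Set ℂ} (hU : IsOpen U)
    (hf : DifferentiableOn ℂ f U) (hint : Integrable fun t : ℝ => f t) {y : ℝ} (hy : (y : ℂ) ∈ U) :
    ∃ r > 0, ∃ H : ℂ → ℂ, DifferentiableOn ℂ H (Metric.ball (y : ℂ) r) ∧
      (∀ w ∈ Metric.ball (y : ℂ) r, w.im < 0 → H w = ∫ t : ℝ, f t / ((t : ℂ) - w)) ∧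
      (∀ w ∈ Metric.ball (y : ℂ) r, 0 < w.im →
        H w = (∫ t : ℝ, f t / ((t : ℂ) - w)) - 2 * Real.pi * Complex.I * f w) := by
  obtain ⟨ε, hε, hεU⟩ := Metric.nhds_basis_closedBall.mem_iff.1 (hU.mem_nhds hy)
  have hfd : ∀ z ∈ Metric.closedBall (y : ℂ) ε, DifferentiableAt ℂ f z := fun z hz =>
    hf.differentiableAt (hU.mem_nhds (hεU hz))
  set V := Metric.ball (y : ℂ) ε with hV
  have hVc : V ⊆ Metric.closedBall (y : ℂ) ε := Metric.ball_subset_closedBall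
  have hfV : DifferentiableOn ℂ f V := hf.mono (hVc.trans hεU)
  obtain ⟨M, hM⟩ := (isCompact_closedBall (y : ℂ) ε).exists_bound_of_continuousOn
    ((hf.deriv hU).continuousOn.mono hεU)
  set S := Ioo (y - ε) (y + ε) with hS
  have hSV : ∀ t ∈ S, (t : ℂ) ∈ V := by
    intro t ht
    rw [hV, Metric.mem_ball, Complex.dist_of_im_eq (by simp), Complex.ofReal_re, Complex.ofReal_re,
      Real.dist_eq, abs_lt]
    constructor <;> linarith [ht.1, ht.2]
  have hre : ∀ w ∈ V, y - ε < w.re ∧ w.re < y + ε := by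
    intro w hw
    have h1 : |w.re - y| ≤ dist w y := by
      simpa [dist_eq_norm] using Complex.abs_re_le_norm (w - y)
    rw [hV, Metric.mem_ball] at hw
    constructor <;> linarith [abs_le.1 h1 |>.1, abs_le.1 h1 |>.2]
  have hslope : ∀ w : ℂ, w.im ≠ 0 → ∀ t : ℝ,
      dslope f t w = f t / ((t : ℂ) - w) - f w * (1 / ((t : ℂ) - w)) := by
    intro w hw t
    have h := ofReal_sub_ne_zero hw t
    rw [dslope_of_ne _ (sub_ne_zero.1 h).symm, slope_def_field]
    have h' : w - (t : ℂ) ≠ 0 := by rw [← neg_sub]; exact neg_ne_zero.2 h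
    field_simp
    ring
  have hK : DifferentiableOn ℂ (fun w => ∫ t in S, dslope f (t : ℂ) w) V := by
    refine differentiableOn_integral_of_dominated Metric.isOpen_ball (bound := fun _ => M)
      (fun w hw => ?_) ?_ ?_ (by simp [hS])
    · have hms : AEStronglyMeasurable (fun t : ℝ => slope f w (t : ℂ)) (volume.restrict S) := by
        simp only [slope_def_field]
        refine (hint.aestronglyMeasurable.restrict.sub aestronglyMeasurable_const).div₀ ?_
        exact (by fun_prop : Measurable fun t : ℝ => (t : ℂ) - w).aestronglyMeasurable
      refine hms.congr (ae_restrict_of_ae ?_)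
      have : ∀ᵐ t : ℝ, t ≠ w.re := by simp [ae_iff]
      filter_upwards [this] with t ht
      rw [dslope_of_ne, slope_comm]
      rintro rfl
      simp at ht
    · refine (ae_restrict_iff' measurableSet_Ioo).2 (Eventually.of_forall fun t ht => ?_)
      exact (Complex.differentiableOn_dslope (Metric.isOpen_ball.mem_nhds (hSV t ht))).2 hfV
    · refine (ae_restrict_iff' measurableSet_Ioo).2 (Eventually.of_forall fun t ht w hw => ?_)
      by_cases h : w = t
      · rw [h, dslope_same]
        exact hM _ (hVc (hSV t ht))
      · rw [dslope_of_ne _ h, slope_def_field, norm_div,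
          div_le_iff₀ (norm_pos_iff.2 (sub_ne_zero.2 h))]
        exact (convex_ball (y : ℂ) ε).norm_image_sub_le_of_norm_deriv_le
          (fun z hz => hfd z (hVc hz)) (fun z hz => hM z (hVc hz)) (hSV t ht) hw
  have hfar : DifferentiableOn ℂ (fun w => ∫ t in Sᶜ, f t / ((t : ℂ) - w))
      (Metric.ball (y : ℂ) (ε / 2)) := by
    refine differentiableOn_cauchyIntegral hint.restrict Metric.isOpen_ball (half_pos hε) ?_
    refine (ae_restrict_iff' measurableSet_Ioo.compl).2 (Eventually.of_forall fun t ht w hw => ?_)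
    have h1 : ε ≤ dist (t : ℂ) y := by
      by_contra! h
      exact ht (by simpa using hre t h)
    rw [Metric.mem_ball] at hw
    rw [← dist_eq_norm]
    linarith [dist_triangle (t : ℂ) w y]
  have hsub : Metric.ball (y : ℂ) (ε / 2) ⊆ V := Metric.ball_subset_ball (by linarith)
  have hsplit : ∀ w : ℂ, w.im ≠ 0 → (∫ t : ℝ, f t / ((t : ℂ) - w)) =
      (∫ t in Sᶜ, f t / ((t : ℂ) - w)) + (∫ t in S, dslope f (t : ℂ) w) +
        f w * (Complex.log (((y + ε : ℝ) : ℂ) - w) - Complex.log (((y - ε : ℝ) : ℂ) - w)) := by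
    intro w hw
    have hi : Integrable (fun t : ℝ => f t / ((t : ℂ) - w)) :=
      integrable_div_ofReal_sub hint (abs_pos.2 hw)
        (Eventually.of_forall fun t => abs_im_le_norm_ofReal_sub t w)
    have hone : IntegrableOn (fun t : ℝ => 1 / ((t : ℂ) - w)) S :=
      integrable_div_ofReal_sub (μ := volume.restrict S) (g := fun _ => 1) (by simp [hS])
        (abs_pos.2 hw) (Eventually.of_forall fun t => abs_im_le_norm_ofReal_sub t w)
    rw [← setIntegral_Ioo_inv_ofReal_sub hw (by linarith),
      ← integral_add_compl (measurableSet_Ioo : MeasurableSet S) hi]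
    simp only [hslope w hw]
    rw [integral_sub hi.integrableOn (hone.const_mul _), integral_const_mul]
    ring
  refine ⟨ε / 2, half_pos hε, fun w => (∫ t in Sᶜ, f t / ((t : ℂ) - w)) +
    (∫ t in S, dslope f (t : ℂ) w) + f w * (Complex.log (((y + ε : ℝ) : ℂ) - w) -
      Complex.log (w - ((y - ε : ℝ) : ℂ)) - Real.pi * Complex.I), ?_, ?_, ?_⟩
  · refine (hfar.add (hK.mono hsub)).add ((hfV.mono hsub).mul (((DifferentiableOn.clog
      (by fun_prop) fun w hw => Or.inl ?_).sub (DifferentiableOn.clog (by fun_prop)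
        fun w hw => Or.inl ?_)).sub_const _))
    · have := (hre w (hsub hw)).2
      simpa using this
    · have := (hre w (hsub hw)).1
      simp only [Complex.sub_re, Complex.ofReal_re]
      linarith
  · intro w _ hw
    rw [hsplit w hw.ne, Complex.log_sub_of_im_neg (z := ((y - ε : ℝ) : ℂ)) (by simpa using hw)]
    ring
  · intro w _ hw
    rw [hsplit w hw.ne', Complex.log_sub_of_im_pos (z := ((y - ε : ℝ) : ℂ)) (by simpa using hw)]
    ring

/-- The Cauchy integral over the real axis continues from the lower half-plane to an entire
function. -/
theorem exists_entire_continuation {f : ℂ → ℂ} {U : Set ℂ} (hU : IsOpen U)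
    (hsub : {z : ℂ | 0 ≤ z.im} ⊆ U) (hf : DifferentiableOn ℂ f U)
    (hint : Integrable fun t : ℝ => f t) :
    ∃ G : ℂ → ℂ, Differentiable ℂ G ∧
      (∀ w : ℂ, w.im < 0 → G w = ∫ t : ℝ, f t / ((t : ℂ) - w)) ∧
      (∀ w : ℂ, 0 < w.im →
        G w = (∫ t : ℝ, f t / ((t : ℂ) - w)) - 2 * Real.pi * Complex.I * f w) := by
  set C : ℂ → ℂ := fun w => ∫ t : ℝ, f t / ((t : ℂ) - w) with hC
  set G : ℂ → ℂ := fun w => if w.im < 0 then C w else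
    if 0 < w.im then C w - 2 * Real.pi * Complex.I * f w else
      limUnder (𝓝[{z | z.im < 0}] w) C with hG
  have hneg : ∀ w : ℂ, w.im < 0 → G w = C w := fun w hw => by simp [hG, hw]
  have hpos : ∀ w : ℂ, 0 < w.im → G w = C w - 2 * Real.pi * Complex.I * f w := fun w hw => by
    simp [hG, hw, hw.le.not_gt]
  refine ⟨G, fun w => ?_, hneg, hpos⟩
  rcases lt_trichotomy w.im 0 with hw | hw | hw
  · refine (differentiableAt_cauchyIntegral hint hw.ne).congr_of_eventuallyEq ?_
    filter_upwards [(isOpen_lt Complex.continuous_im continuous_const).mem_nhds hw] with z hz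
      using hneg z hz
  · obtain ⟨y, rfl⟩ : ∃ y : ℝ, w = y := ⟨w.re, Complex.ext rfl (by simpa using hw)⟩
    obtain ⟨r, hr, H, hH, hHneg, hHpos⟩ := exists_local_continuation hU hf hint
      (hsub (by simp : (y : ℂ) ∈ {z : ℂ | 0 ≤ z.im}))
    refine (hH.differentiableAt (Metric.ball_mem_nhds _ hr)).congr_of_eventuallyEq ?_
    filter_upwards [Metric.ball_mem_nhds (y : ℂ) hr] with z hz
    rcases lt_trichotomy z.im 0 with hz' | hz' | hz'
    · rw [hneg z hz', hHneg z hz hz']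
    · have : (𝓝[{z : ℂ | z.im < 0}] z).NeBot := by
        rw [← mem_closure_iff_nhdsWithin_neBot, Complex.closure_setOfPred_im_lt]
        exact hz'.le
      have hlim : Tendsto C (𝓝[{z : ℂ | z.im < 0}] z) (𝓝 (H z)) := by
        have hball := Metric.isOpen_ball.mem_nhds hz
        refine ((hH.differentiableAt hball).continuousAt.tendsto.mono_left
          nhdsWithin_le_nhds).congr' ?_
        filter_upwards [self_mem_nhdsWithin, mem_nhdsWithin_of_mem_nhds hball] with x hx hx'
          using hHneg x hx' hx
      simpa [hG, hz'] using hlim.limUnder_eq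
    · rw [hpos z hz', hHpos z hz hz']
  · refine ((differentiableAt_cauchyIntegral hint hw.ne').sub
      ((hf.differentiableAt (hU.mem_nhds (hsub hw.le))).const_mul
        (2 * Real.pi * Complex.I))).congr_of_eventuallyEq ?_
    filter_upwards [(isOpen_lt continuous_const Complex.continuous_im).mem_nhds hw] with z hz
      using hpos z hz

/-- Analytic continuation of a Cauchy-type integral: if `f` is holomorphic in a
neighborhood of the closed upper half-plane and integrable on `ℝ`, then
`F(z) = ∫ f(ω)/(z-iω) dω` extends to an entire function `F̃` with `F̃ = F` on
`Re z > 0`, `F̃ = F + 2π f(-iz)` on `Re z < 0`, and `F̃(iy) = lim_{x→0+} F(x+iy)`. -/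
theorem stmt2 (f : ℂ → ℂ)
    (hf : ∃ U : Set ℂ, IsOpen U ∧ {z : ℂ | 0 ≤ z.im} ⊆ U ∧ DifferentiableOn ℂ f U)
    (hint : Integrable (fun ω : ℝ => f ω))
    (F : ℂ → ℂ)
    (hF : ∀ z : ℂ, z.re ≠ 0 → F z = ∫ ω : ℝ, f ω / (z - Complex.I * (ω : ℂ)))
    (hconv : ∀ z : ℂ, z.re ≠ 0 → Integrable (fun ω : ℝ => f ω / (z - Complex.I * (ω : ℂ)))) :
    ∃ Ftilde : ℂ → ℂ, Differentiable ℂ Ftilde ∧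
      (∀ z : ℂ, 0 < z.re → Ftilde z = F z) ∧
      (∀ z : ℂ, z.re < 0 → Ftilde z = F z + 2 * Real.pi * f (-(Complex.I) * z)) ∧
      (∀ y : ℝ, Tendsto (fun x : ℝ => F ((x : ℂ) + Complex.I * (y : ℂ))) (𝓝[>] 0)
        (𝓝 (Ftilde (Complex.I * (y : ℂ))))) := by
  obtain ⟨U, hU, hsub, hfU⟩ := hf
  obtain ⟨G, hG, hneg, hpos⟩ := exists_entire_continuation hU hsub hfU hint
  have hFC : ∀ z : ℂ, z.re ≠ 0 →
      F z = Complex.I * ∫ t : ℝ, f t / ((t : ℂ) - -Complex.I * z) := by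
    intro z hz
    rw [hF z hz, ← integral_const_mul]
    congr 1 with t
    have h : (t : ℂ) - -Complex.I * z = Complex.I * (z - Complex.I * t) := by
      linear_combination (t : ℂ) * Complex.I_mul_I
    rw [h, mul_div_assoc', mul_div_mul_left _ _ Complex.I_ne_zero]
  have hright : ∀ z : ℂ, 0 < z.re → Complex.I * G (-Complex.I * z) = F z := by
    intro z hz
    rw [hFC z hz.ne', hneg _ (by simpa using hz)]
  refine ⟨fun z => Complex.I * G (-Complex.I * z), ?_, hright, fun z hz => ?_, fun y => ?_⟩
  · exact (hG.comp (differentiable_id.const_mul _)).const_mul _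
  · simp only
    rw [hFC z hz.ne, hpos _ (by simpa using hz)]
    linear_combination (-2 * Real.pi * f (-Complex.I * z)) * Complex.I_mul_I
  · have hcont : Continuous fun x : ℝ =>
        Complex.I * G (-Complex.I * ((x : ℂ) + Complex.I * (y : ℂ))) :=
      continuous_const.mul (hG.continuous.comp (by fun_prop))
    have h0 := (hcont.tendsto 0).mono_left (nhdsWithin_le_nhds (s := Ioi 0))
    simp only [Complex.ofReal_zero, zero_add] at h0
    refine h0.congr' ?_
    filter_upwards [self_mem_nhdsWithin] with x hx
    exact hright _ (by simpa using hx)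
end

section
/- Let g : ℝ → ℝ be a smooth integrable probability density whose derivatives g^(k), k ≤ n, are integrable and such that all boundary terms vanish at ±∞. Then lim_{z→0+, z real} ∫_ℝ g(ω)/(z - iω)^{n+1} dω = (i^n π / n!) ( g^{(n)}(0) - i H[g^{(n)}](0) ), where H denotes the Hilbert transform. -/
open MeasureTheory Filter Topology Set

lemma sub_I_mul_ne_zero {z : ℝ} (hz : 0 < z) (ω : ℝ) : (z : ℂ) - Complex.I * (ω : ℂ) ≠ 0 := by
  intro h
  have := congrArg Complex.re h
  simp at this
  exact hz.ne' this

lemma integrable_div_sub_I_mul_pow {f : ℝ → ℝ} (hf : Integrable f) {z : ℝ} (hz : 0 < z) (m : ℕ) :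
    Integrable fun ω : ℝ => (f ω : ℂ) / ((z : ℂ) - Complex.I * (ω : ℂ)) ^ m := by
  have hcont : Continuous fun ω : ℝ => (((z : ℂ) - Complex.I * (ω : ℂ)) ^ m)⁻¹ :=
    Continuous.inv₀ (by fun_prop) fun ω => pow_ne_zero _ (sub_I_mul_ne_zero hz ω)
  have hbound (ω : ℝ) : ‖(((z : ℂ) - Complex.I * (ω : ℂ)) ^ m)⁻¹‖ ≤ (z ^ m)⁻¹ := by
    rw [norm_inv, norm_pow]
    have h := Complex.abs_re_le_norm ((z : ℂ) - Complex.I * (ω : ℂ))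
    simp only [Complex.sub_re, Complex.ofReal_re, Complex.mul_re, Complex.I_re, zero_mul,
      Complex.I_im, Complex.ofReal_im, mul_zero, sub_zero, abs_of_pos hz] at h
    gcongr
  have hf' : Integrable fun ω : ℝ => (f ω : ℂ) := hf.ofReal
  simpa only [div_eq_mul_inv] using
    hf'.mul_bdd hcont.aestronglyMeasurable (Eventually.of_forall hbound)

/-- One integration by parts against a power of `(z - iω)⁻¹`. -/
lemma integral_div_sub_I_mul_pow_succ {f f' : ℝ → ℝ} (hf : ∀ x, HasDerivAt f (f' x) x)
    (hfi : Integrable f) (hfi' : Integrable f') {z : ℝ} (hz : 0 < z) (m : ℕ) :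
    ∫ ω : ℝ, (f ω : ℂ) / ((z : ℂ) - Complex.I * (ω : ℂ)) ^ (m + 2) =
      Complex.I / (m + 1 : ℂ) *
        ∫ ω : ℝ, (f' ω : ℂ) / ((z : ℂ) - Complex.I * (ω : ℂ)) ^ (m + 1) := by
  have hm : (m + 1 : ℂ) ≠ 0 := by exact_mod_cast m.succ_ne_zero
  have hv (x : ℝ) : HasDerivAt (fun ω : ℝ => (((z : ℂ) - Complex.I * (ω : ℂ)) ^ (m + 1))⁻¹)
      ((m + 1) * Complex.I * (((z : ℂ) - Complex.I * (x : ℂ)) ^ (m + 2))⁻¹) x := by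
    have h0 := sub_I_mul_ne_zero hz x
    have h1 : HasDerivAt (fun ω : ℝ => (z : ℂ) - Complex.I * (ω : ℂ)) (-Complex.I) x := by
      simpa using ((Complex.ofRealCLM.hasDerivAt (x := x)).const_mul Complex.I).const_sub (z : ℂ)
    refine ((h1.pow (m + 1)).inv (pow_ne_zero _ h0)).congr_deriv ?_
    simp only [Pi.pow_apply, Nat.add_sub_cancel]
    push_cast
    field_simp
    ring
  have h := integral_mul_deriv_eq_deriv_mul_of_integrable (u := fun x => (f x : ℂ))
    (u' := fun x => (f' x : ℂ)) (fun x _ => (hf x).ofReal_comp) (fun x _ => hv x)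
    (((integrable_div_sub_I_mul_pow hfi hz (m + 2)).const_mul ((m + 1) * Complex.I)).congr
      (Eventually.of_forall fun x => by simp only [Pi.mul_apply]; ring))
    (integrable_div_sub_I_mul_pow hfi' hz (m + 1)) (integrable_div_sub_I_mul_pow hfi hz (m + 1))
  simp only [div_eq_mul_inv (f' _ : ℂ)]
  rw [← neg_eq_iff_eq_neg.mpr h, ← integral_neg, ← integral_const_mul]
  refine integral_congr_ae (Eventually.of_forall fun x => ?_)
  have h0 := sub_I_mul_ne_zero hz x
  dsimp only
  field_simp
  simp

lemma integral_div_sub_I_mul_pow (n : ℕ) {g : ℝ → ℝ} (hg : ContDiff ℝ (⊤ : ℕ∞) g)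
    (hg_int : ∀ k ≤ n, Integrable (iteratedDeriv k g)) {z : ℝ} (hz : 0 < z) :
    ∫ ω : ℝ, (g ω : ℂ) / ((z : ℂ) - Complex.I * (ω : ℂ)) ^ (n + 1) =
      Complex.I ^ n / (n.factorial : ℂ) *
        ∫ ω : ℝ, ((iteratedDeriv n g ω : ℝ) : ℂ) / ((z : ℂ) - Complex.I * (ω : ℂ)) := by
  induction n generalizing g with
  | zero => simp
  | succ n ih =>
    have hd : ∀ x, HasDerivAt g (deriv g x) x := fun x =>
      (hg.differentiable (by simp) x).hasDerivAt
    have hg' : ContDiff ℝ (⊤ : ℕ∞) (deriv g) := (contDiff_infty_iff_deriv.mp hg).2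
    rw [integral_div_sub_I_mul_pow_succ hd (by simpa using hg_int 0 (by simp))
      (by simpa using hg_int 1 (by simp)) hz n,
      ih hg' fun k hk => by simpa [iteratedDeriv_succ'] using hg_int (k + 1) (by simpa using hk),
      iteratedDeriv_succ', Nat.factorial_succ]
    push_cast
    simp only [div_eq_mul_inv, mul_inv]
    ring

/-- The Poisson kernel `z / (z² + s²)` is `π` times an approximate identity. -/
lemma tendsto_integral_poisson_mul {f : ℝ → ℝ} (hf : Integrable f) (hc : ContinuousAt f 0) :
    Tendsto (fun z : ℝ => ∫ s, z / (z ^ 2 + s ^ 2) * f s) (𝓝[>] 0) (𝓝 (Real.pi * f 0)) := by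
  have hdecay : Tendsto (fun x : ℝ => ‖x‖ ^ Module.finrank ℝ ℝ * (Real.pi⁻¹ * (1 + x ^ 2)⁻¹))
      (Bornology.cobounded ℝ) (𝓝 0) := by
    have h1 : Tendsto (fun x : ℝ => Real.pi⁻¹ * ‖x‖⁻¹) (Bornology.cobounded ℝ) (𝓝 0) := by
      simpa using (tendsto_inv_atTop_zero.comp (tendsto_norm_cobounded_atTop (E := ℝ))).const_mul Real.pi⁻¹
    refine squeeze_zero (fun x => by positivity) (fun x => ?_) h1
    rcases eq_or_ne x 0 with rfl | hx
    · simp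
    have hx' : 0 < ‖x‖ := norm_pos_iff.mpr hx
    have : ‖x‖ * (1 + x ^ 2)⁻¹ ≤ ‖x‖⁻¹ := by
      rw [← div_eq_mul_inv, div_le_iff₀ (by positivity), inv_mul_eq_div, le_div_iff₀ hx',
        ← sq, Real.norm_eq_abs, sq_abs]
      linarith
    calc _ = Real.pi⁻¹ * (‖x‖ * (1 + x ^ 2)⁻¹) := by simp; ring
      _ ≤ _ := by gcongr
  have key := (tendsto_integral_comp_smul_smul_of_integrable (μ := volume)
    (φ := fun x : ℝ => Real.pi⁻¹ * (1 + x ^ 2)⁻¹) (fun x => by positivity)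
    (by rw [integral_const_mul, integral_univ_inv_one_add_sq, inv_mul_cancel₀ Real.pi_ne_zero])
    hdecay hf hc).comp tendsto_inv_nhdsGT_zero
  refine (key.const_mul Real.pi).congr' ?_
  filter_upwards [self_mem_nhdsWithin] with z (hz : 0 < z)
  rw [Function.comp_apply, ← integral_const_mul]
  refine integral_congr_ae (Eventually.of_forall fun s => ?_)
  have := Real.pi_ne_zero
  have : z ^ 2 + s ^ 2 ≠ 0 := by positivity
  simp only [Module.finrank_self, pow_one, smul_eq_mul]
  field_simp

/-- The difference between the conjugate Poisson kernel and the truncated kernel `1 / s`. -/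
noncomputable def conjPoissonDefect (z s : ℝ) : ℝ :=
  s / (z ^ 2 + s ^ 2) - {s : ℝ | z ≤ |s|}.indicator (fun s => s⁻¹) s

lemma measurableSet_le_abs (z : ℝ) : MeasurableSet {s : ℝ | z ≤ |s|} :=
  measurableSet_le measurable_const measurable_id.abs

lemma measurable_conjPoissonDefect (z : ℝ) : Measurable (conjPoissonDefect z) :=
  (by fun_prop : Measurable fun s : ℝ => s / (z ^ 2 + s ^ 2)).sub
    (measurable_inv.indicator (measurableSet_le_abs z))

lemma conjPoissonDefect_neg (z s : ℝ) : conjPoissonDefect z (-s) = -conjPoissonDefect z s := by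
  by_cases h : z ≤ |s|
  · simp [conjPoissonDefect, h, neg_div]
    ring
  · simp [conjPoissonDefect, h, neg_div]

lemma abs_conjPoissonDefect_le {z : ℝ} (hz : 0 < z) (s : ℝ) :
    |conjPoissonDefect z s| ≤ z / (z ^ 2 + s ^ 2) := by
  have hp : 0 < z ^ 2 + s ^ 2 := by positivity
  by_cases h : z ≤ |s|
  · have hs' : 0 < |s| := hz.trans_le h
    have hs : s ≠ 0 := abs_pos.mp hs'
    have : conjPoissonDefect z s = -(z ^ 2 / (z ^ 2 + s ^ 2) / s) := by
      simp only [conjPoissonDefect, indicator, mem_ofPred_eq, h, if_true]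
      field_simp
      ring
    rw [this, abs_neg, abs_div, abs_of_nonneg (by positivity), div_le_iff₀ hs', div_mul_eq_mul_div]
    gcongr
    nlinarith
  · have : conjPoissonDefect z s = s / (z ^ 2 + s ^ 2) := by simp [conjPoissonDefect, h]
    rw [this, abs_div, abs_of_pos hp]
    gcongr
    exact (not_le.mp h).le

lemma div_sq_add_sq_le_inv {z : ℝ} (hz : 0 < z) (s : ℝ) : z / (z ^ 2 + s ^ 2) ≤ z⁻¹ := by
  rw [div_le_iff₀ (by positivity), inv_mul_eq_div, le_div_iff₀ hz]
  nlinarith [sq_nonneg s]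

lemma integrable_poisson_mul {f : ℝ → ℝ} (hf : Integrable f) {z : ℝ} (hz : 0 < z) :
    Integrable fun s => z / (z ^ 2 + s ^ 2) * f s :=
  hf.bdd_mul (by fun_prop : Measurable fun s : ℝ => z / (z ^ 2 + s ^ 2)).aestronglyMeasurable
    (Eventually.of_forall fun s => by
      rw [Real.norm_of_nonneg (by positivity)]; exact div_sq_add_sq_le_inv hz s)

lemma integrable_conjPoissonDefect_mul {f : ℝ → ℝ} (hf : Integrable f) {z : ℝ} (hz : 0 < z) :
    Integrable fun s => conjPoissonDefect z s * f s :=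
  hf.bdd_mul (measurable_conjPoissonDefect z).aestronglyMeasurable
    (Eventually.of_forall fun s =>
      (abs_conjPoissonDefect_le hz s).trans (div_sq_add_sq_le_inv hz s))

lemma integrable_indicator_inv_mul {f : ℝ → ℝ} (hf : Integrable f) {z : ℝ} (hz : 0 < z) :
    Integrable fun s => {s : ℝ | z ≤ |s|}.indicator (fun s => s⁻¹) s * f s := by
  refine hf.bdd_mul (c := z⁻¹)
    (measurable_inv.indicator (measurableSet_le_abs z)).aestronglyMeasurable
    (Eventually.of_forall fun s => ?_)
  by_cases h : z ≤ |s|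
  · simp only [indicator, mem_ofPred_eq, h, if_true, norm_inv, Real.norm_eq_abs]
    gcongr
  · simp [h, hz.le]

lemma tendsto_integral_conjPoissonDefect_mul {f : ℝ → ℝ} (hf : Integrable f)
    (hc : ContinuousAt f 0) :
    Tendsto (fun z : ℝ => ∫ s, conjPoissonDefect z s * f s) (𝓝[>] 0) (𝓝 0) := by
  set h : ℝ → ℝ := fun s => f s - f 0 * (1 + s ^ 2)⁻¹ with hh
  have hχ : Integrable fun s : ℝ => f 0 * (1 + s ^ 2)⁻¹ := integrable_inv_one_add_sq.const_mul _
  have hhi : Integrable h := hf.sub hχ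
  have hχc : ContinuousAt (fun s : ℝ => f 0 * (1 + s ^ 2)⁻¹) 0 :=
    continuousAt_const.mul (ContinuousAt.inv₀ (by fun_prop) (by simp))
  have hP := tendsto_integral_poisson_mul hhi.abs (hc.sub hχc).abs
  have h0 : Real.pi * |h 0| = 0 := by simp [hh]
  rw [h0] at hP
  refine squeeze_zero_norm' ?_ hP
  filter_upwards [self_mem_nhdsWithin] with z (hz : 0 < z)
  have hodd : ∫ s, conjPoissonDefect z s * (f 0 * (1 + s ^ 2)⁻¹) = 0 := by
    have h1 := integral_neg_eq_self
      (fun s => conjPoissonDefect z s * (f 0 * (1 + s ^ 2)⁻¹)) volume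
    simp only [conjPoissonDefect_neg, neg_mul, even_two, Even.neg_pow, integral_neg] at h1
    linarith
  have hsplit : ∫ s, conjPoissonDefect z s * f s = ∫ s, conjPoissonDefect z s * h s := by
    have := integral_sub (integrable_conjPoissonDefect_mul hf hz)
      (integrable_conjPoissonDefect_mul hχ hz)
    rw [hodd, sub_zero] at this
    rw [← this]
    simp only [hh, mul_sub]
  rw [hsplit]
  refine norm_integral_le_of_norm_le (integrable_poisson_mul hhi.abs hz)
    (Eventually.of_forall fun s => ?_)
  rw [norm_mul, Real.norm_eq_abs, Real.norm_eq_abs]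
  gcongr
  exact abs_conjPoissonDefect_le hz s

/-- The Sokhotski–Plemelj formula at the origin. -/
lemma tendsto_integral_div_sub_I_mul {f : ℝ → ℝ} (hf : Integrable f) (hc : ContinuousAt f 0)
    {L : ℝ} (hL : Tendsto (fun ε : ℝ => ∫ s in {s : ℝ | ε ≤ |s|}, f s / (0 - s))
      (𝓝[>] 0) (𝓝 L)) :
    Tendsto (fun z : ℝ => ∫ ω : ℝ, (f ω : ℂ) / ((z : ℂ) - Complex.I * (ω : ℂ)))
      (𝓝[>] 0) (𝓝 ((Real.pi * f 0 : ℝ) - Complex.I * (L : ℂ))) := by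
  have h1 := (Complex.continuous_ofReal.tendsto _).comp (tendsto_integral_poisson_mul hf hc)
  have h2 := (Complex.continuous_ofReal.tendsto _).comp
    (hL.sub (tendsto_integral_conjPoissonDefect_mul hf hc))
  rw [sub_zero] at h2
  refine (h1.sub (h2.const_mul Complex.I)).congr' ?_
  filter_upwards [self_mem_nhdsWithin] with z (hz : 0 < z)
  have htrunc : ∫ s in {s : ℝ | z ≤ |s|}, f s / (0 - s) =
      -∫ s, {s : ℝ | z ≤ |s|}.indicator (fun s => s⁻¹) s * f s := by
    rw [← integral_indicator (measurableSet_le_abs z), ← integral_neg]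
    refine integral_congr_ae (Eventually.of_forall fun s => ?_)
    by_cases h : z ≤ |s|
    · simp [h, div_neg]
      ring
    · simp [h]
  have hconj : (∫ s in {s : ℝ | z ≤ |s|}, f s / (0 - s)) - ∫ s, conjPoissonDefect z s * f s =
      -∫ s, s / (z ^ 2 + s ^ 2) * f s := by
    rw [htrunc, ← neg_add', ← integral_add (integrable_indicator_inv_mul hf hz)
      (integrable_conjPoissonDefect_mul hf hz)]
    simp only [conjPoissonDefect, ← add_mul, add_sub_cancel]
  have hconj_int : Integrable fun s => s / (z ^ 2 + s ^ 2) * f s :=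
    ((integrable_indicator_inv_mul hf hz).add (integrable_conjPoissonDefect_mul hf hz)).congr
      (Eventually.of_forall fun s => by
        simp only [Pi.add_apply, conjPoissonDefect, ← add_mul, add_sub_cancel])
  simp only [Function.comp_apply]
  rw [hconj, Complex.ofReal_neg, mul_neg, sub_neg_eq_add, ← integral_complex_ofReal,
    ← integral_complex_ofReal, ← integral_const_mul, ← integral_add]
  · refine integral_congr_ae (Eventually.of_forall fun s => ?_)
    have h0 := sub_I_mul_ne_zero hz s
    have hp : (z : ℂ) ^ 2 + (s : ℂ) ^ 2 ≠ 0 := by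
      exact_mod_cast (by positivity : z ^ 2 + s ^ 2 ≠ 0)
    push_cast
    rw [eq_div_iff h0]
    field_simp
    linear_combination (-(f s : ℂ) * s ^ 2) * Complex.I_sq
  · exact (integrable_poisson_mul hf hz).ofReal
  · exact hconj_int.ofReal.const_mul _

/-- `lim_{z→0+} ∫ g(ω)/(z-iω)^{n+1} dω = (iⁿπ/n!)(g⁽ⁿ⁾(0) - i H[g⁽ⁿ⁾](0))`,
where `H[f](0) = (1/π) PV ∫ f(s)/(0-s) ds` is the Hilbert transform at `0`. -/
theorem stmt3 (n : ℕ) (g : ℝ → ℝ) (hg : ContDiff ℝ (⊤ : ℕ∞) g)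
    (hg_int : ∀ k ≤ n, Integrable (iteratedDeriv k g))
    (Hn : ℝ)
    (hH : Tendsto (fun ε : ℝ => ∫ s in {s : ℝ | ε ≤ |s|}, iteratedDeriv n g s / (0 - s))
      (𝓝[>] 0) (𝓝 (Real.pi * Hn))) :
    Tendsto (fun z : ℝ => ∫ ω : ℝ, (g ω : ℂ) / ((z : ℂ) - Complex.I * (ω : ℂ)) ^ (n + 1))
      (𝓝[>] 0)
      (𝓝 (Complex.I ^ n * (Real.pi : ℂ) / (n.factorial : ℂ) *
        ((iteratedDeriv n g 0 : ℝ) - Complex.I * (Hn : ℂ)))) := by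
  have h := (tendsto_integral_div_sub_I_mul (hg_int n le_rfl)
    (hg.continuous_iteratedDeriv n (by exact_mod_cast le_top)).continuousAt hH).const_mul
    (Complex.I ^ n / (n.factorial : ℂ))
  have hlim : Complex.I ^ n * (Real.pi : ℂ) / (n.factorial : ℂ) *
      ((iteratedDeriv n g 0 : ℝ) - Complex.I * (Hn : ℂ)) =
      Complex.I ^ n / (n.factorial : ℂ) *
        ((Real.pi * iteratedDeriv n g 0 : ℝ) - Complex.I * ((Real.pi * Hn : ℝ) : ℂ)) := by
    push_cast
    ring
  rw [hlim]
  refine h.congr' ?_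
  filter_upwards [self_mem_nhdsWithin] with z (hz : 0 < z)
  exact (integral_div_sub_I_mul_pow n hg hg_int hz).symm
end
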